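/- Let μ be a probability measure on G = SL_d(ℝ) with finite first moment, i.e. ∫_G log‖g‖ dμ(g) < ∞, and let λ₁(μ) = inf_{n≥1} (1/n) ∫_G log‖g‖ dμⁿ(g) be the top Lyapunov exponent, where μⁿ is the n-fold convolution power and ‖·‖ is the operator norm associated to the Euclidean norm on ℝ^d. Let π_V be the Koopman representation of G on L²(ℝ^d, m), m being Lebesgue measure, associated to the natural linear action of G on V = ℝ^d. Then λ₁(μ) ≥ (1/d) · log(1/r_spec(π_V(μ))), where r_spec denotes the spectral radius of the averaging operator π_V(μ)f = ∫_G π_V(g)f dμ(g). -/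

import Mathlib

open MeasureTheory Filter Topology

/-- `SL_d(ℝ)` carries the topology induced from the space of matrices. -/
instance {d : ℕ} : TopologicalSpace (Matrix.SpecialLinearGroup (Fin d) ℝ) :=
  TopologicalSpace.induced
    (fun g : Matrix.SpecialLinearGroup (Fin d) ℝ => (g : Matrix (Fin d) (Fin d) ℝ))
    inferInstance

noncomputable instance {d : ℕ} : MeasurableSpace (Matrix.SpecialLinearGroup (Fin d) ℝ) :=
  borel _

instance {d : ℕ} : BorelSpace (Matrix.SpecialLinearGroup (Fin d) ℝ) := ⟨rfl⟩

/-- The operator norm of `g ∈ SL_d(ℝ)` with respect to the Euclidean norm on `ℝ^d`. -/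
noncomputable def slOpNorm {d : ℕ} (g : Matrix.SpecialLinearGroup (Fin d) ℝ) : ℝ :=
  ‖LinearMap.toContinuousLinearMap
    (Matrix.toEuclideanLin (g : Matrix (Fin d) (Fin d) ℝ))‖

/-- The convolution of two measures on a group: the pushforward of the product measure
under multiplication. -/
noncomputable def mconv {G : Type*} [Monoid G] [MeasurableSpace G]
    (μ ν : Measure G) : Measure G :=
  Measure.map (fun p : G × G => p.1 * p.2) (μ.prod ν)

/-- `n`-fold convolution power of a measure on a group (`ν⁰ = δ_e`). -/
noncomputable def convPow {G : Type*} [Monoid G] [MeasurableSpace G]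
    (ν : Measure G) : ℕ → Measure G
  | 0 => Measure.dirac 1
  | n + 1 => mconv (convPow ν n) ν

open Matrix

instance {d : ℕ} : SecondCountableTopology (SpecialLinearGroup (Fin d) ℝ) :=
  have : SecondCountableTopology (Matrix (Fin d) (Fin d) ℝ) :=
    inferInstanceAs (SecondCountableTopology (Fin d → Fin d → ℝ))
  TopologicalSpace.secondCountableTopology_induced _ _ _

theorem continuous_coe_specialLinearGroup {d : ℕ} :
    Continuous fun g : SpecialLinearGroup (Fin d) ℝ => (g : Matrix (Fin d) (Fin d) ℝ) :=
  continuous_induced_dom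

instance {d : ℕ} : ContinuousMul (SpecialLinearGroup (Fin d) ℝ) where
  continuous_mul := by
    refine continuous_induced_rng.2 ?_
    exact (continuous_coe_specialLinearGroup.comp continuous_fst).matrix_mul
      (continuous_coe_specialLinearGroup.comp continuous_snd)

theorem continuous_coe_inv_specialLinearGroup {d : ℕ} :
    Continuous fun g : SpecialLinearGroup (Fin d) ℝ =>
      ((g⁻¹ : SpecialLinearGroup (Fin d) ℝ) : Matrix (Fin d) (Fin d) ℝ) :=
  continuous_coe_specialLinearGroup.matrix_adjugate

instance isProbabilityMeasure_mconv {G : Type*} [Monoid G] [MeasurableSpace G] [MeasurableMul₂ G]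
    (μ ν : Measure G) [IsProbabilityMeasure μ] [IsProbabilityMeasure ν] :
    IsProbabilityMeasure (mconv μ ν) :=
  Measure.isProbabilityMeasure_map measurable_mul.aemeasurable

instance isProbabilityMeasure_convPow {G : Type*} [Monoid G] [MeasurableSpace G]
    [MeasurableMul₂ G] (ν : Measure G) [IsProbabilityMeasure ν] (n : ℕ) :
    IsProbabilityMeasure (convPow ν n) := by
  induction n with
  | zero => exact Measure.dirac.isProbabilityMeasure
  | succ n ih => exact isProbabilityMeasure_mconv _ _

/-- A continuous subadditive nonnegative function on a group is integrable with respect to the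
convolution of two measures integrating it, and its integral is subadditive. -/
theorem integrable_mconv_of_subadditive {G : Type*} [Monoid G] [MeasurableSpace G]
    [MeasurableMul₂ G] {φ : G → ℝ} (hφm : Measurable φ) (hφ0 : ∀ g, 0 ≤ φ g)
    (hφ : ∀ g h, φ (g * h) ≤ φ g + φ h) (μ ν : Measure G) [IsProbabilityMeasure μ]
    [IsProbabilityMeasure ν] (hμ : Integrable φ μ) (hν : Integrable φ ν) :
    Integrable φ (mconv μ ν) ∧ ∫ g, φ g ∂(mconv μ ν) ≤ ∫ g, φ g ∂μ + ∫ g, φ g ∂ν := by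
  have h1 : Integrable (fun p : G × G => φ p.1) (μ.prod ν) := hμ.comp_fst ν
  have h2 : Integrable (fun p : G × G => φ p.2) (μ.prod ν) := hν.comp_snd μ
  have h3 : Integrable (fun p : G × G => φ (p.1 * p.2)) (μ.prod ν) := by
    refine (h1.add h2).mono' (hφm.comp measurable_mul).aestronglyMeasurable (.of_forall fun p => ?_)
    rw [Real.norm_of_nonneg (hφ0 _)]
    exact hφ _ _
  refine ⟨(integrable_map_measure hφm.aestronglyMeasurable measurable_mul.aemeasurable).2 h3, ?_⟩
  rw [mconv, integral_map measurable_mul.aemeasurable hφm.aestronglyMeasurable]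
  calc _ ≤ ∫ p : G × G, (φ p.1 + φ p.2) ∂(μ.prod ν) := integral_mono h3 (h1.add h2) fun p => hφ _ _
    _ = _ := by rw [integral_add h1 h2, integral_fun_fst, integral_fun_snd]; simp

theorem integrable_convPow_of_subadditive {G : Type*} [Monoid G] [MeasurableSpace G]
    [MeasurableMul₂ G] {φ : G → ℝ} (hφm : Measurable φ) (hφ0 : ∀ g, 0 ≤ φ g) (hφ1 : φ 1 = 0)
    (hφ : ∀ g h, φ (g * h) ≤ φ g + φ h) (ν : Measure G) [IsProbabilityMeasure ν]
    (hν : Integrable φ ν) (n : ℕ) :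
    Integrable φ (convPow ν n) ∧ ∫ g, φ g ∂(convPow ν n) ≤ n * ∫ g, φ g ∂ν := by
  induction n with
  | zero =>
    refine ⟨integrable_dirac' hφm.stronglyMeasurable (by simp), ?_⟩
    rw [convPow, integral_dirac' _ _ hφm.stronglyMeasurable]
    simp [hφ1]
  | succ n ih =>
    have := integrable_mconv_of_subadditive hφm hφ0 hφ (convPow ν n) ν ih.1 hν
    refine ⟨this.1, this.2.trans ?_⟩
    push_cast
    linarith [ih.2]

/-- Powers of the averaging operator of `ν` are the averaging operators of the convolution
powers of `ν`. -/
theorem pow_apply_eq_integral_convPow {G H : Type*} [Monoid G] [MeasurableSpace G]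
    [MeasurableMul₂ G] [NormedAddCommGroup H] [NormedSpace ℂ H] [CompleteSpace H]
    (π : G →* (H ≃ₗᵢ[ℂ] H)) (hπ : ∀ f, StronglyMeasurable fun g => π g f) (ν : Measure G)
    [IsProbabilityMeasure ν] (S : H →L[ℂ] H) (hS : ∀ f, S f = ∫ g, π g f ∂ν) (n : ℕ) (f : H) :
    (S ^ n) f = ∫ g, π g f ∂(convPow ν n) := by
  induction n generalizing f with
  | zero => rw [convPow, integral_dirac' _ _ (hπ f)]; simp
  | succ n ih =>
    rw [pow_succ, mul_apply_eq_comp, ih, convPow, mconv,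
      integral_map measurable_mul.aemeasurable (hπ f).aestronglyMeasurable, integral_prod]
    · refine integral_congr_ae (.of_forall fun g => ?_)
      have hint : Integrable (fun h => π h f) ν :=
        Integrable.of_bound (hπ f).aestronglyMeasurable ‖f‖ (.of_forall fun h => by simp)
      have := ((π g).toContinuousLinearEquiv : H →L[ℂ] H).integral_comp_comm hint
      simp only [hS, map_mul]
      exact this.symm
    · exact Integrable.of_bound ((hπ f).comp_measurable measurable_mul).aestronglyMeasurable ‖f‖
        (.of_forall fun h => by simp)

section Geometry

variable {d : ℕ}

theorem norm_mulVec_le_slOpNorm_mul (g : SpecialLinearGroup (Fin d) ℝ) (x : Fin d → ℝ) :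
    ‖WithLp.toLp 2 ((g : Matrix (Fin d) (Fin d) ℝ) *ᵥ x)‖ ≤ slOpNorm g * ‖WithLp.toLp 2 x‖ :=
  (LinearMap.toContinuousLinearMap (toEuclideanLin (g : Matrix (Fin d) (Fin d) ℝ))).le_opNorm
    (WithLp.toLp 2 x)

theorem slOpNorm_mul_le (g h : SpecialLinearGroup (Fin d) ℝ) :
    slOpNorm (g * h) ≤ slOpNorm g * slOpNorm h := by
  refine ContinuousLinearMap.opNorm_le_bound _ (mul_nonneg (norm_nonneg _) (norm_nonneg _))
    fun x => ?_
  have h1 := norm_mulVec_le_slOpNorm_mul g ((h : Matrix (Fin d) (Fin d) ℝ) *ᵥ x.ofLp)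
  have h2 := norm_mulVec_le_slOpNorm_mul h x.ofLp
  rw [mulVec_mulVec] at h1
  rw [mul_assoc]
  exact h1.trans (mul_le_mul_of_nonneg_left h2 (norm_nonneg _))

theorem continuous_slOpNorm : Continuous (slOpNorm (d := d)) := by
  let L : Matrix (Fin d) (Fin d) ℝ →ₗ[ℝ]
      (EuclideanSpace ℝ (Fin d) →L[ℝ] EuclideanSpace ℝ (Fin d)) :=
    LinearMap.toContinuousLinearMap.toLinearMap ∘ₗ
      (toEuclideanLin (𝕜 := ℝ) (m := Fin d) (n := Fin d)).toLinearMap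
  exact (L.continuous_of_finiteDimensional.comp continuous_coe_specialLinearGroup).norm

/-- The Euclidean unit ball, as a subset of `Fin d → ℝ`. -/
def euclideanUnitBall (d : ℕ) : Set (Fin d → ℝ) := {x | ‖WithLp.toLp 2 x‖ ≤ 1}

theorem measurableSet_euclideanUnitBall : MeasurableSet (euclideanUnitBall d) :=
  (isClosed_le (by fun_prop) continuous_const).measurableSet

theorem preimage_toLp_closedBall :
    WithLp.toLp 2 ⁻¹' Metric.closedBall (0 : EuclideanSpace ℝ (Fin d)) 1 =
      euclideanUnitBall d := by
  ext x; simp [euclideanUnitBall]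

theorem volume_euclideanUnitBall :
    volume (euclideanUnitBall d) =
      volume (Metric.closedBall (0 : EuclideanSpace ℝ (Fin d)) 1) := by
  rw [← preimage_toLp_closedBall]
  exact (PiLp.volume_preserving_toLp (Fin d)).measure_preimage
    measurableSet_closedBall.nullMeasurableSet

theorem volume_euclideanUnitBall_ne_top : volume (euclideanUnitBall d) ≠ ⊤ := by
  rw [volume_euclideanUnitBall]
  exact measure_closedBall_lt_top.ne

theorem volume_real_euclideanUnitBall_pos : 0 < volume.real (euclideanUnitBall d) := by
  refine ENNReal.toReal_pos ?_ volume_euclideanUnitBall_ne_top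
  rw [volume_euclideanUnitBall]
  exact (Metric.measure_closedBall_pos _ _ one_pos).ne'

theorem measurePreserving_mulVec (g : SpecialLinearGroup (Fin d) ℝ) :
    MeasurePreserving (fun x : Fin d → ℝ => (g : Matrix (Fin d) (Fin d) ℝ) *ᵥ x)
      volume volume := by
  refine ⟨(by fun_prop : Continuous fun x : Fin d → ℝ =>
    (g : Matrix (Fin d) (Fin d) ℝ) *ᵥ x).measurable, ?_⟩
  have := Real.map_matrix_volume_pi_eq_smul_volume_pi
    (M := (g : Matrix (Fin d) (Fin d) ℝ)) (by simp)
  rw [show (g : Matrix (Fin d) (Fin d) ℝ).det = 1 from g.2, inv_one, abs_one, ENNReal.ofReal_one, one_smul] at this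
  exact this

theorem one_le_slOpNorm (hd : 1 ≤ d) (g : SpecialLinearGroup (Fin d) ℝ) : 1 ≤ slOpNorm g := by
  have hs : 0 ≤ slOpNorm g := norm_nonneg _
  have hsub : euclideanUnitBall d ⊆
      (fun x : Fin d → ℝ => (g : Matrix (Fin d) (Fin d) ℝ) *ᵥ x) ⁻¹'
        {x | ‖WithLp.toLp 2 x‖ ≤ slOpNorm g} := fun x hx =>
    (norm_mulVec_le_slOpNorm_mul g x).trans (mul_le_of_le_one_right hs hx)
  have hball : {x : Fin d → ℝ | ‖WithLp.toLp 2 x‖ ≤ slOpNorm g} =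
      WithLp.toLp 2 ⁻¹' Metric.closedBall (0 : EuclideanSpace ℝ (Fin d)) (slOpNorm g) := by
    ext x; simp
  have hle := measure_mono (μ := volume) hsub
  have : Nonempty (Fin d) := ⟨⟨0, hd⟩⟩
  rw [(measurePreserving_mulVec g).measure_preimage
    (isClosed_le (by fun_prop) continuous_const).measurableSet.nullMeasurableSet, hball,
    (PiLp.volume_preserving_toLp (Fin d)).measure_preimage
      measurableSet_closedBall.nullMeasurableSet, volume_euclideanUnitBall,
    Measure.addHaar_closedBall' _ _ hs, finrank_euclideanSpace_fin] at hle
  by_contra! hlt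
  have hpos := Metric.measure_closedBall_pos volume (0 : EuclideanSpace ℝ (Fin d)) one_pos
  refine hle.not_gt ?_
  conv_rhs => rw [← one_mul (volume _)]
  refine ENNReal.mul_lt_mul_left hpos.ne' measure_closedBall_lt_top.ne ?_
  rw [ENNReal.ofReal_lt_one]
  exact pow_lt_one₀ hs hlt (by omega)

open scoped Pointwise in
/-- The unit ball and its image under `g` overlap in volume at least `‖g‖⁻ᵈ` times that of
the ball. -/
theorem inv_pow_mul_volume_le (hd : 1 ≤ d) (g : SpecialLinearGroup (Fin d) ℝ) :
    (slOpNorm g ^ d)⁻¹ * volume.real (euclideanUnitBall d) ≤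
      volume.real (euclideanUnitBall d ∩ (fun x : Fin d → ℝ =>
        ((g⁻¹ : SpecialLinearGroup (Fin d) ℝ) : Matrix (Fin d) (Fin d) ℝ) *ᵥ x) ⁻¹'
          euclideanUnitBall d) := by
  have hs := one_le_slOpNorm hd g
  have hs0 : 0 < slOpNorm g := one_pos.trans_le hs
  have hmp := measurePreserving_mulVec g
  have hmp' := measurePreserving_mulVec g⁻¹
  have hsub : (slOpNorm g)⁻¹ • euclideanUnitBall d ⊆
      (fun x : Fin d → ℝ => (g : Matrix (Fin d) (Fin d) ℝ) *ᵥ x) ⁻¹'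
        (euclideanUnitBall d ∩ (fun x : Fin d → ℝ =>
          ((g⁻¹ : SpecialLinearGroup (Fin d) ℝ) : Matrix (Fin d) (Fin d) ℝ) *ᵥ x) ⁻¹'
            euclideanUnitBall d) := by
    rintro _ ⟨x, hx, rfl⟩
    have hx' : ‖WithLp.toLp 2 ((slOpNorm g)⁻¹ • x)‖ ≤ (slOpNorm g)⁻¹ := by
      rw [WithLp.toLp_smul, norm_smul, Real.norm_of_nonneg (by positivity)]
      exact mul_le_of_le_one_right (by positivity) hx
    refine ⟨?_, ?_⟩
    · refine (norm_mulVec_le_slOpNorm_mul g _).trans ?_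
      refine (mul_le_mul_of_nonneg_left hx' hs0.le).trans ?_
      rw [mul_inv_cancel₀ hs0.ne']
    · have hinv : ((g⁻¹ : SpecialLinearGroup (Fin d) ℝ) : Matrix (Fin d) (Fin d) ℝ) *
          (g : Matrix (Fin d) (Fin d) ℝ) = 1 := congrArg Subtype.val (inv_mul_cancel g)
      rw [Set.mem_preimage, mulVec_mulVec, hinv, one_mulVec]
      exact hx'.trans (inv_le_one_of_one_le₀ hs)
  have hmeas := measurableSet_euclideanUnitBall.inter
    (hmp'.measurable (measurableSet_euclideanUnitBall (d := d)))
  have hle := measure_mono (μ := volume) hsub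
  rw [hmp.measure_preimage hmeas.nullMeasurableSet, Measure.addHaar_smul, Module.finrank_fin_fun,
    abs_of_nonneg (by positivity), inv_pow] at hle
  have := ENNReal.toReal_mono
    (measure_ne_top_of_subset Set.inter_subset_left volume_euclideanUnitBall_ne_top) hle
  rwa [ENNReal.toReal_mul, ENNReal.toReal_ofReal (by positivity)] at this

end Geometry

section Koopman

variable {d : ℕ}
  {π : SpecialLinearGroup (Fin d) ℝ →*
    (Lp ℂ 2 (volume : Measure (Fin d → ℝ)) ≃ₗᵢ[ℂ] Lp ℂ 2 (volume : Measure (Fin d → ℝ)))}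

theorem continuous_koopman
    (hπ : ∀ (g : SpecialLinearGroup (Fin d) ℝ)
      (f : Lp ℂ 2 (volume : Measure (Fin d → ℝ))), ∀ᵐ x ∂(volume : Measure (Fin d → ℝ)),
      (π g f) x = f (((g⁻¹ : SpecialLinearGroup (Fin d) ℝ) : Matrix (Fin d) (Fin d) ℝ) *ᵥ x))
    (f : Lp ℂ 2 (volume : Measure (Fin d → ℝ))) : Continuous fun g => π g f := by
  let Φ : SpecialLinearGroup (Fin d) ℝ → C(Fin d → ℝ, Fin d → ℝ) := fun g =>
    ⟨fun x => ((g⁻¹ : SpecialLinearGroup (Fin d) ℝ) : Matrix (Fin d) (Fin d) ℝ) *ᵥ x,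
      by fun_prop⟩
  have hΦ : Continuous Φ := ContinuousMap.continuous_of_continuous_uncurry _
    ((continuous_coe_inv_specialLinearGroup.comp continuous_fst).matrix_mulVec continuous_snd)
  have hmp : ∀ g, MeasurePreserving (Φ g) volume volume := fun g => measurePreserving_mulVec g⁻¹
  have heq : (fun g => π g f) = fun g => Lp.compMeasurePreserving (Φ g) (hmp g) f := by
    funext g
    refine Lp.ext ?_
    filter_upwards [hπ g f, Lp.coeFn_compMeasurePreserving f (hmp g)] with x h1 h2
    rw [h1, h2]; rfl
  rw [heq]
  exact continuous_const.compMeasurePreservingLp hΦ hmp (by simp)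

/-- The indicator function of the Euclidean unit ball in `L²`. -/
noncomputable def unitBallIndicator (d : ℕ) : Lp ℂ 2 (volume : Measure (Fin d → ℝ)) :=
  indicatorConstLp 2 measurableSet_euclideanUnitBall volume_euclideanUnitBall_ne_top 1

theorem inner_unitBallIndicator_koopman
    (hπ : ∀ (g : SpecialLinearGroup (Fin d) ℝ)
      (f : Lp ℂ 2 (volume : Measure (Fin d → ℝ))), ∀ᵐ x ∂(volume : Measure (Fin d → ℝ)),
      (π g f) x = f (((g⁻¹ : SpecialLinearGroup (Fin d) ℝ) : Matrix (Fin d) (Fin d) ℝ) *ᵥ x))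
    (g : SpecialLinearGroup (Fin d) ℝ) :
    inner ℂ (unitBallIndicator d) (π g (unitBallIndicator d)) =
      (volume.real (euclideanUnitBall d ∩ (fun x : Fin d → ℝ =>
        ((g⁻¹ : SpecialLinearGroup (Fin d) ℝ) : Matrix (Fin d) (Fin d) ℝ) *ᵥ x) ⁻¹'
          euclideanUnitBall d) : ℂ) := by
  have hmp := measurePreserving_mulVec g⁻¹
  have hpre := hmp.measurable (measurableSet_euclideanUnitBall (d := d))
  have hae : π g (unitBallIndicator d) =ᵐ[volume] ((fun x : Fin d → ℝ =>
        ((g⁻¹ : SpecialLinearGroup (Fin d) ℝ) : Matrix (Fin d) (Fin d) ℝ) *ᵥ x) ⁻¹'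
          euclideanUnitBall d).indicator fun _ => (1 : ℂ) := by
    filter_upwards [hπ g (unitBallIndicator d), hmp.quasiMeasurePreserving.ae
      (indicatorConstLp_coeFn (p := 2) (hs := measurableSet_euclideanUnitBall (d := d))
        (hμs := volume_euclideanUnitBall_ne_top) (c := (1 : ℂ)))] with x h1 h2
    rw [h1, unitBallIndicator, h2]; rfl
  refine (L2.inner_indicatorConstLp_one measurableSet_euclideanUnitBall
    volume_euclideanUnitBall_ne_top (π g (unitBallIndicator d))).trans ?_
  rw [integral_congr_ae (ae_restrict_of_ae hae),
    setIntegral_indicator hpre]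
  simp

/-- Jensen's inequality turns the overlap estimate into a lower bound for the norm of an
averaging operator. -/
theorem exp_neg_integral_log_le_norm (hd : 1 ≤ d)
    (hπ : ∀ (g : SpecialLinearGroup (Fin d) ℝ)
      (f : Lp ℂ 2 (volume : Measure (Fin d → ℝ))), ∀ᵐ x ∂(volume : Measure (Fin d → ℝ)),
      (π g f) x = f (((g⁻¹ : SpecialLinearGroup (Fin d) ℝ) : Matrix (Fin d) (Fin d) ℝ) *ᵥ x))
    (ν : Measure (SpecialLinearGroup (Fin d) ℝ)) [IsProbabilityMeasure ν]
    (hν : Integrable (fun g => Real.log (slOpNorm g)) ν)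
    (S : Lp ℂ 2 (volume : Measure (Fin d → ℝ)) →L[ℂ] Lp ℂ 2 (volume : Measure (Fin d → ℝ)))
    (hS : ∀ f, S f = ∫ g, π g f ∂ν) :
    Real.exp (-(d * ∫ g, Real.log (slOpNorm g) ∂ν)) ≤ ‖S‖ := by
  have hpos := volume_real_euclideanUnitBall_pos (d := d)
  have hexp : ∀ g : SpecialLinearGroup (Fin d) ℝ,
      Real.exp (-(d * Real.log (slOpNorm g))) = (slOpNorm g ^ d)⁻¹ := fun g => by
    rw [Real.exp_neg, Real.exp_nat_mul, Real.exp_log (one_pos.trans_le (one_le_slOpNorm hd g))]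
  have hint : Integrable (fun g => Real.exp (-(d * Real.log (slOpNorm g)))) ν := by
    refine Integrable.of_bound (Real.measurable_exp.comp_aemeasurable
      (hν.aemeasurable.const_mul _).neg).aestronglyMeasurable 1 (.of_forall fun g => ?_)
    rw [Real.norm_of_nonneg (Real.exp_pos _).le, Real.exp_le_one_iff]
    have := Real.log_nonneg (one_le_slOpNorm hd g)
    have : 0 ≤ d * Real.log (slOpNorm g) := by positivity
    linarith
  have hjensen := convexOn_exp.map_integral_le (μ := ν) Real.continuous_exp.continuousOn
    isClosed_univ (.of_forall fun _ => Set.mem_univ _) (hν.const_mul (d : ℝ)).neg hint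
  simp only [Pi.neg_apply, integral_neg, integral_const_mul] at hjensen
  refine hjensen.trans ?_
  let u := unitBallIndicator d
  have hcont := continuous_koopman hπ u
  have hintπ : Integrable (fun g => π g u) ν :=
    Integrable.of_bound hcont.aestronglyMeasurable ‖u‖ (.of_forall fun g => by simp)
  have hinner : inner ℂ u (S u) = ∫ g, (inner ℂ u (π g u) : ℂ) ∂ν := by
    rw [hS, ← integral_inner hintπ]
  have hintR : Integrable (fun g => volume.real (euclideanUnitBall d ∩ (fun x : Fin d → ℝ =>
        ((g⁻¹ : SpecialLinearGroup (Fin d) ℝ) : Matrix (Fin d) (Fin d) ℝ) *ᵥ x) ⁻¹'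
          euclideanUnitBall d)) ν := by
    have := (hintπ.const_inner (𝕜 := ℂ) u).re
    simpa only [u, inner_unitBallIndicator_koopman hπ, RCLike.re_to_complex,
      Complex.ofReal_re] using this
  have hunorm : ‖u‖ * ‖u‖ = volume.real (euclideanUnitBall d) := by
    have h := inner_unitBallIndicator_koopman hπ 1
    have h' := inner_self_eq_norm_mul_norm (𝕜 := ℂ) u
    simp only [map_one, LinearIsometryEquiv.coe_one, id] at h
    rw [← h', h]
    simp
  simp only [u, inner_unitBallIndicator_koopman hπ, integral_complex_ofReal] at hinner
  have hupper : ∫ g, volume.real (euclideanUnitBall d ∩ (fun x : Fin d → ℝ =>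
        ((g⁻¹ : SpecialLinearGroup (Fin d) ℝ) : Matrix (Fin d) (Fin d) ℝ) *ᵥ x) ⁻¹'
          euclideanUnitBall d) ∂ν ≤ ‖S‖ * volume.real (euclideanUnitBall d) := by
    calc _ ≤ ‖(inner ℂ u (S u) : ℂ)‖ := by
          rw [hinner, Complex.norm_real]; exact le_abs_self _
      _ ≤ ‖u‖ * ‖S u‖ := norm_inner_le_norm _ _
      _ ≤ ‖u‖ * (‖S‖ * ‖u‖) := by gcongr; exact S.le_opNorm u
      _ = _ := by rw [← hunorm]; ring
  refine le_of_mul_le_mul_right (le_trans ?_ hupper) hpos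
  rw [← integral_mul_const]
  refine integral_mono (hint.mul_const _) hintR fun g => ?_
  simp only [hexp]
  exact inv_pow_mul_volume_le hd g

end Koopman

/-- If `c ^ m ≤ ‖a ^ m‖` for all multiples `m` of some `n ≠ 0`, then the spectral radius of
`a` is at least `c`. -/
theorem le_spectralRadius_toReal_of_pow_le {A : Type*} [NormedRing A] [NormedAlgebra ℂ A]
    [CompleteSpace A] (a : A) {c : ℝ} (hc : 0 ≤ c) {n : ℕ} (hn : n ≠ 0)
    (h : ∀ k, c ^ (n * k) ≤ ‖a ^ (n * k)‖) : c ≤ (spectralRadius ℂ a).toReal := by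
  have hlim := (spectrum.pow_norm_pow_one_div_tendsto_nhds_spectralRadius a).comp
    (tendsto_id.const_mul_atTop' (Nat.pos_of_ne_zero hn))
  have hle : ENNReal.ofReal c ≤ spectralRadius ℂ a := by
    refine ge_of_tendsto hlim ?_
    filter_upwards [eventually_ge_atTop 1] with k hk
    have hnk : n * k ≠ 0 := Nat.mul_ne_zero hn (by omega)
    refine ENNReal.ofReal_le_ofReal ?_
    calc c = (c ^ (n * k)) ^ (1 / ((n * k : ℕ) : ℝ)) := by
          rw [one_div, Real.pow_rpow_inv_natCast hc hnk]
      _ ≤ _ := Real.rpow_le_rpow (by positivity) (h k) (by positivity)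
  have hfin : spectralRadius ℂ a ≠ ⊤ :=
    ne_top_of_le_ne_top (by simp [ENNReal.mul_eq_top]) (spectrum.spectralRadius_le_pow_nnnorm_pow_one_div ℂ a 0)
  exact (ENNReal.ofReal_le_iff_le_toReal hfin).1 hle

/-- Let `μ` be a probability measure on `G = SL_d(ℝ)` with finite first moment, and let
`λ₁(μ) = inf_{n ≥ 1} (1/n) ∫ log‖g‖ dμⁿ(g)` be the top Lyapunov exponent.  Let `π_V` be the
Koopman representation of `G` on `L²(ℝ^d)` (Lebesgue measure) for the natural linear action,
and `π_V(μ)` the averaging operator.  Then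
`λ₁(μ) ≥ (1/d) · log (1 / r_spec(π_V(μ)))`. -/
theorem lyapunov_exponent_lower_bound
    {d : ℕ} (hd : 1 ≤ d)
    (μ : Measure (Matrix.SpecialLinearGroup (Fin d) ℝ)) [IsProbabilityMeasure μ]
    (hmoment : Integrable (fun g => Real.log (slOpNorm g)) μ)
    (πV : Matrix.SpecialLinearGroup (Fin d) ℝ →*
      (Lp ℂ 2 (volume : Measure (Fin d → ℝ)) ≃ₗᵢ[ℂ] Lp ℂ 2 (volume : Measure (Fin d → ℝ))))
    (hKoopman : ∀ (g : Matrix.SpecialLinearGroup (Fin d) ℝ)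
      (f : Lp ℂ 2 (volume : Measure (Fin d → ℝ))), ∀ᵐ x ∂(volume : Measure (Fin d → ℝ)),
      (πV g f) x = f (Matrix.mulVec
        ((g⁻¹ : Matrix.SpecialLinearGroup (Fin d) ℝ) : Matrix (Fin d) (Fin d) ℝ) x))
    (T : Lp ℂ 2 (volume : Measure (Fin d → ℝ)) →L[ℂ] Lp ℂ 2 (volume : Measure (Fin d → ℝ)))
    (hT : ∀ f, T f = ∫ g, πV g f ∂μ) :
    (1 / (d : ℝ)) * Real.log (1 / (spectralRadius ℂ T).toReal) ≤
      sInf {r : ℝ | ∃ n : ℕ, 1 ≤ n ∧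
        r = (1 / (n : ℝ)) * ∫ g, Real.log (slOpNorm g) ∂(convPow μ n)} := by
  have hm : Measurable fun g : SpecialLinearGroup (Fin d) ℝ => Real.log (slOpNorm g) :=
    Real.measurable_log.comp continuous_slOpNorm.measurable
  have hpos : ∀ g : SpecialLinearGroup (Fin d) ℝ, 0 < slOpNorm g := fun g =>
    one_pos.trans_le (one_le_slOpNorm hd g)
  have h0 : ∀ g : SpecialLinearGroup (Fin d) ℝ, 0 ≤ Real.log (slOpNorm g) := fun g =>
    Real.log_nonneg (one_le_slOpNorm hd g)
  have h1 : Real.log (slOpNorm (1 : SpecialLinearGroup (Fin d) ℝ)) = 0 := by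
    have hle : slOpNorm (1 : SpecialLinearGroup (Fin d) ℝ) ≤ 1 :=
      ContinuousLinearMap.opNorm_le_bound _ zero_le_one fun x => by simp
    rw [le_antisymm hle (one_le_slOpNorm hd 1), Real.log_one]
  have hsub : ∀ g h : SpecialLinearGroup (Fin d) ℝ,
      Real.log (slOpNorm (g * h)) ≤ Real.log (slOpNorm g) + Real.log (slOpNorm h) := fun g h => by
    rw [← Real.log_mul (hpos g).ne' (hpos h).ne']
    exact Real.log_le_log (hpos _) (slOpNorm_mul_le g h)
  have hπ : ∀ f, StronglyMeasurable fun g => πV g f := fun f =>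
    (continuous_koopman hKoopman f).stronglyMeasurable
  refine le_csInf ⟨_, 1, le_rfl, rfl⟩ ?_
  rintro _ ⟨n, hn, rfl⟩
  have hn0 : (0 : ℝ) < n := by exact_mod_cast hn
  have hd0 : (0 : ℝ) < d := by exact_mod_cast hd
  set l := ∫ g, Real.log (slOpNorm g) ∂(convPow μ n) with hl
  have hint := (integrable_convPow_of_subadditive hm h0 h1 hsub μ hmoment n).1
  have hr : Real.exp (-(d * l / n)) ≤ (spectralRadius ℂ T).toReal := by
    refine le_spectralRadius_toReal_of_pow_le T (Real.exp_pos _).le (Nat.one_le_iff_ne_zero.1 hn)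
      fun k => ?_
    obtain ⟨hint_k, hle_k⟩ :=
      integrable_convPow_of_subadditive hm h0 h1 hsub (convPow μ n) hint k
    have hnorm := exp_neg_integral_log_le_norm hd hKoopman (convPow (convPow μ n) k) hint_k
      ((T ^ n) ^ k) (pow_apply_eq_integral_convPow πV hπ _ (T ^ n)
        (pow_apply_eq_integral_convPow πV hπ μ T hT n) k)
    rw [pow_mul T]
    refine le_trans ?_ hnorm
    rw [← Real.exp_nat_mul, Real.exp_le_exp]
    have : ((n * k : ℕ) : ℝ) * -(d * l / n) = -(d * (k * l)) := by
      push_cast; field_simp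
    rw [this]
    gcongr
  have hlog := Real.log_le_log (Real.exp_pos _) hr
  rw [Real.log_exp] at hlog
  rw [one_div (spectralRadius ℂ T).toReal, Real.log_inv, one_div, one_div,
    inv_mul_le_iff₀ hd0]
  have : (d : ℝ) * ((n : ℝ)⁻¹ * l) = d * l / n := by ring
  linarith
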